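/- arXiv:1910.12778 — 2 statements merged into one kernel-verified Lean document; each statement's English description precedes it below -/
import Mathlib

section
/- Assume the iterates (x^k, y^k, w^k), k ≥ 0, are generated by LP-ADMM steps with constant penalty parameter ρ > (√3 + 1)·L_f, and let (x*, y*, w*) be a KKT point. Define m_k = (1/(2ρ))‖w^k − w*‖² + (ρ/2)‖y^k − y*‖² − B_f(y*, y^k). Then (i) m_k ≥ 0 for every k ≥ 0, and (ii) for every k ≥ 1, m_{k+1} + (L_f²/(2ρ))‖y^{k+1} − y^k‖² ≤ m_k + (L_f²/(2ρ))‖y^k − y^{k−1}‖²; that is, the sequence k ↦ m_k + (L_f²/(2ρ))‖y^k − y^{k−1}‖² is non-increasing and bounded below. -/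
open scoped RealInnerProductSpace

lemma aux_small (a b : ℝ) (h : ∀ t : ℝ, 0 < t → t ≤ 1 → 0 ≤ t * a + t ^ 2 * b) : 0 ≤ a := by
  by_contra ha
  push Not at ha
  have hd : 0 < |b| - a := by have := abs_nonneg b; linarith
  have ht : 0 < -a / (2 * (|b| - a)) := div_pos (by linarith) (by linarith)
  have h1 := h (-a / (2 * (|b| - a))) ht (by
    rw [div_le_one (by linarith)]
    have := abs_nonneg b
    linarith)
  set t := -a / (2 * (|b| - a)) with htd
  have e : t * (2 * (|b| - a)) = -a := by
    rw [htd]; field_simp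
  have h2 : 0 ≤ a + t * b := by
    by_contra hc
    push Not at hc
    nlinarith
  have h3 : t * b ≤ t * |b| := mul_le_mul_of_nonneg_left (le_abs_self b) ht.le
  nlinarith

section
variable {E F : Type*} [NormedAddCommGroup E] [InnerProductSpace ℝ E]
  [NormedAddCommGroup F] [InnerProductSpace ℝ F]

lemma aux_x (A : F →L[ℝ] E) (C : Set F) (hC : Convex ℝ C) (c d : E) (x : F) (hxC : x ∈ C)
    (hx : IsMinOn (fun u => ‖A u - c - d‖ ^ 2) C x) (u : F) (hu : u ∈ C) :
    0 ≤ ⟪A x - c - d, A u - A x⟫ := by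
  have key := aux_small (2 * ⟪A x - c - d, A u - A x⟫) (‖A u - A x‖ ^ 2) ?_
  · linarith
  intro t ht ht1
  have hm : x + t • (u - x) ∈ C := hC.add_smul_sub_mem hxC hu ⟨ht.le, ht1⟩
  have h := isMinOn_iff.1 hx _ hm
  have e : A (x + t • (u - x)) - c - d = (A x - c - d) + t • (A u - A x) := by
    rw [map_add, map_smul, map_sub]; abel
  simp only [e] at h
  rw [norm_add_sq_real, norm_smul, real_inner_smul_right, mul_pow, Real.norm_eq_abs, sq_abs] at h
  linarith

lemma aux_y (P : E → ℝ) (hP : ConvexOn ℝ Set.univ P) (ρ : ℝ) (c y : E)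
    (hy : IsMinOn (fun z => ρ / 2 * ‖z - c‖ ^ 2 + P z) Set.univ y) (z : E) :
    0 ≤ ρ * ⟪y - c, z - y⟫ + P z - P y := by
  refine aux_small _ (ρ / 2 * ‖z - y‖ ^ 2) ?_
  intro t ht ht1
  have h := isMinOn_iff.1 hy (y + t • (z - y)) (Set.mem_univ _)
  have e : y + t • (z - y) - c = (y - c) + t • (z - y) := by abel
  have hc := hP.2 (Set.mem_univ y) (Set.mem_univ z) (sub_nonneg.2 ht1) ht.le (by ring)
  have e2 : (1 - t) • y + t • z = y + t • (z - y) := by module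
  rw [e2] at hc
  simp only [e] at h
  rw [norm_add_sq_real, norm_smul, real_inner_smul_right, mul_pow, Real.norm_eq_abs, sq_abs] at h
  simp only [smul_eq_mul] at hc
  linarith

variable [CompleteSpace E]

lemma aux_line (f : E → ℝ) (f' : E → E) (hgrad : ∀ z, HasGradientAt f (f' z) z) (v d : E) (t : ℝ) :
    HasDerivAt (fun s : ℝ => f (v + s • d)) ⟪f' (v + t • d), d⟫ t := by
  have h1 : HasDerivAt (fun s : ℝ => v + s • d) d t := by
    simpa using ((hasDerivAt_id t).smul_const d).const_add v
  have h2 := (hgrad (v + t • d)).hasFDerivAt.comp_hasDerivAt t h1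
  rw [InnerProductSpace.toDual_apply_apply] at h2
  exact h2

lemma aux_convex (f : E → ℝ) (hf : ConvexOn ℝ Set.univ f) (f' : E → E)
    (hgrad : ∀ z, HasGradientAt f (f' z) z) (u v : E) :
    0 ≤ f u - f v - ⟪f' v, u - v⟫ := by
  have hc : ConvexOn ℝ Set.univ (fun s : ℝ => f (v + s • (u - v))) := by
    refine ⟨convex_univ, ?_⟩
    intro a _ b _ p q hp hq hpq
    have := hf.2 (Set.mem_univ (v + a • (u - v))) (Set.mem_univ (v + b • (u - v))) hp hq hpq
    have e : p • (v + a • (u - v)) + q • (v + b • (u - v))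
        = v + (p • a + q • b) • (u - v) := by
      have : p = 1 - q := by linarith
      subst this
      simp only [smul_eq_mul]
      module
    rwa [e] at this
  have h := hc.le_slope_of_hasDerivAt (Set.mem_univ (0:ℝ)) (Set.mem_univ (1:ℝ)) one_pos
    (aux_line f f' hgrad v (u - v) 0)
  simp [slope_def_field] at h
  linarith

lemma aux_descent (f : E → ℝ) (f' : E → E)
    (hgrad : ∀ z, HasGradientAt f (f' z) z) (L : ℝ)
    (hlip : ∀ a b, ‖f' a - f' b‖ ≤ L * ‖a - b‖) (u v : E) :
    f u - f v - ⟪f' v, u - v⟫ ≤ L / 2 * ‖u - v‖ ^ 2 := by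
  set d := u - v with hd
  have hD : ∀ t : ℝ, HasDerivAt
      (fun s : ℝ => f (v + s • d) - s * ⟪f' v, d⟫ - L / 2 * ‖d‖ ^ 2 * s ^ 2)
      (⟪f' (v + t • d), d⟫ - ⟪f' v, d⟫ - L / 2 * ‖d‖ ^ 2 * (2 * t)) t := by
    intro t
    have h1 := (hasDerivAt_id t).mul_const ⟪f' v, d⟫
    have h2 := ((hasDerivAt_id t).pow 2).const_mul (L / 2 * ‖d‖ ^ 2)
    have := ((aux_line f f' hgrad v d t).sub h1).sub h2
    refine this.congr_deriv ?_
    simp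
  have hanti := antitoneOn_of_deriv_nonpos (convex_Icc (0:ℝ) 1)
    (fun t _ => (hD t).continuousAt.continuousWithinAt)
    (fun t _ => (hD t).differentiableAt.differentiableWithinAt) (by
      intro t ht
      rw [interior_Icc] at ht
      rw [(hD t).deriv, ← inner_sub_left]
      have h1 := real_inner_le_norm (f' (v + t • d) - f' v) d
      have h2 := hlip (v + t • d) v
      rw [add_sub_cancel_left, norm_smul, Real.norm_eq_abs, abs_of_pos ht.1] at h2
      have h3 := mul_le_mul_of_nonneg_right h2 (norm_nonneg d)
      nlinarith)
  have := hanti (by simp : (0:ℝ) ∈ Set.Icc (0:ℝ) 1) (by simp : (1:ℝ) ∈ Set.Icc (0:ℝ) 1) zero_le_one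
  have e : v + d = u := by rw [hd]; abel
  simp [e] at this
  linarith

end

/-- Proposition 4.1(c): for LP-ADMM iterates with constant penalty
`ρ > (√3 + 1)L_f` and a KKT point `(x*, y*, w*)`, the quantity
`m_k = (1/(2ρ))‖w^k − w*‖² + (ρ/2)‖y^k − y*‖² − B_f(y*, y^k)` is nonnegative,
and `k ↦ m_k + (L_f²/(2ρ))‖y^k − y^{k−1}‖²` is non-increasing for `k ≥ 1`. -/
theorem lpadmm_lyapunov_monotone
    {n N : ℕ} (hn : 0 < n) (hN : 0 < N)
    (A : EuclideanSpace ℝ (Fin n) →L[ℝ] EuclideanSpace ℝ (Fin N))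
    (C : Set (EuclideanSpace ℝ (Fin n)))
    (hCne : C.Nonempty) (hCconv : Convex ℝ C) (hCclosed : IsClosed C)
    (P : EuclideanSpace ℝ (Fin N) → ℝ) (hP : ConvexOn ℝ Set.univ P)
    (f : EuclideanSpace ℝ (Fin N) → ℝ) (hf : ConvexOn ℝ Set.univ f)
    (f' : EuclideanSpace ℝ (Fin N) → EuclideanSpace ℝ (Fin N))
    (hgrad : ∀ z, HasGradientAt f (f' z) z)
    (Lf : ℝ) (hLf : 0 < Lf)
    (hlip : ∀ a b, ‖f' a - f' b‖ ≤ Lf * ‖a - b‖)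
    (ρ : ℝ) (hρ : (Real.sqrt 3 + 1) * Lf < ρ)
    (x : ℕ → EuclideanSpace ℝ (Fin n)) (y w : ℕ → EuclideanSpace ℝ (Fin N))
    (hx : ∀ k, x (k+1) ∈ C ∧
      IsMinOn (fun u => ‖A u - y k - ρ⁻¹ • w k‖ ^ 2) C (x (k+1)))
    (hy : ∀ k, IsMinOn
      (fun z => ρ / 2 * ‖z - (A (x (k+1)) - ρ⁻¹ • (w k + f' (y k)))‖ ^ 2 + P z)
      Set.univ (y (k+1)))
    (hw : ∀ k, w (k+1) = w k - ρ • (A (x (k+1)) - y (k+1)))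
    (Bf : EuclideanSpace ℝ (Fin N) → EuclideanSpace ℝ (Fin N) → ℝ)
    (hBf : ∀ u v, Bf u v = f u - f v - ⟪f' v, u - v⟫)
    (xs : EuclideanSpace ℝ (Fin n)) (ys ws : EuclideanSpace ℝ (Fin N))
    (hxsC : xs ∈ C) (hAxs : A xs = ys)
    (hkkt_x : ∀ xx ∈ C, ⟪ws, A xx - A xs⟫ ≤ 0)
    (hkkt_y : ∀ z, P ys + ⟪-ws - f' ys, z - ys⟫ ≤ P z)
    (m : ℕ → ℝ)
    (hm : ∀ k, m k = 1 / (2 * ρ) * ‖w k - ws‖ ^ 2 + ρ / 2 * ‖y k - ys‖ ^ 2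
      - Bf ys (y k)) :
    (∀ k, 0 ≤ m k) ∧
      (∀ k, 1 ≤ k →
        m (k+1) + Lf ^ 2 / (2 * ρ) * ‖y (k+1) - y k‖ ^ 2 ≤
          m k + Lf ^ 2 / (2 * ρ) * ‖y k - y (k-1)‖ ^ 2) := by
  have hρ0 : 0 < ρ := lt_trans (by positivity) hρ
  have hs : Real.sqrt 3 ^ 2 = 3 := Real.sq_sqrt (by norm_num)
  have hs0 : 0 ≤ Real.sqrt 3 := Real.sqrt_nonneg 3
  have hLρ : Lf < ρ := by nlinarith
  have hquad : 2 * Lf * ρ + 2 * Lf ^ 2 ≤ ρ ^ 2 := by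
    have h1 : Real.sqrt 3 * Lf ≤ ρ - Lf := by linarith
    have h2 : (Real.sqrt 3 * Lf) ^ 2 ≤ (ρ - Lf) ^ 2 := by
      apply pow_le_pow_left₀ (by positivity) h1
    rw [mul_pow, hs] at h2
    nlinarith
  refine ⟨fun k => ?_, fun k hk => ?_⟩
  · rw [hm, hBf]
    have h1 := aux_descent f f' hgrad Lf hlip ys (y k)
    rw [norm_sub_rev ys (y k)] at h1
    have h2 : 0 ≤ 1 / (2 * ρ) * ‖w k - ws‖ ^ 2 := by positivity
    have h3 : Lf / 2 * ‖y k - ys‖ ^ 2 ≤ ρ / 2 * ‖y k - ys‖ ^ 2 :=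
      mul_le_mul_of_nonneg_right (by linarith) (by positivity)
    linarith
  obtain ⟨j, rfl⟩ : ∃ j, k = j + 1 := ⟨k - 1, by omega⟩
  rw [Nat.add_sub_cancel]
  -- subgradient relation of the `y`-step
  have hsub : ∀ k z, 0 ≤ ⟪w (k+1) + f' (y k), z - y (k+1)⟫ + P z - P (y (k+1)) := by
    intro k z
    have h := aux_y P hP ρ _ _ (hy k) z
    rw [← real_inner_smul_left] at h
    have e : ρ • (y (k+1) - (A (x (k+1)) - ρ⁻¹ • (w k + f' (y k)))) = w (k+1) + f' (y k) := by
      rw [hw k]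
      simp only [smul_sub, smul_add, smul_smul, mul_inv_cancel₀ hρ0.ne', one_smul]
      abel
    rwa [e] at h
  have hP1 := hsub (j+1) (y (j+1))
  have hP2 := hsub j (y (j+1+1))
  have hP3 := hsub (j+1) ys
  have hP4 := hkkt_y (y (j+1+1))
  have hX1 := aux_x A C hCconv _ _ _ (hx (j+1)).1 (hx (j+1)).2 xs hxsC
  have hX2 := hkkt_x _ (hx (j+1)).1
  have hAx : A (x (j+1+1)) = y (j+1+1) - ρ⁻¹ • (w (j+1+1) - w (j+1)) := by
    rw [hw (j+1)]
    simp only [smul_sub, smul_smul, sub_sub_cancel_left, smul_neg, inv_mul_cancel₀ hρ0.ne', one_smul]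
    abel
  rw [hAx, hAxs] at hX1 hX2
  have hB1 := aux_descent f f' hgrad Lf hlip (y (j+1+1)) (y (j+1))
  have hB2 := aux_convex f hf f' hgrad (y (j+1+1)) ys
  have hB3 := aux_convex f hf f' hgrad ys (y (j+1+1))
  have hG : ⟪f' (y j) - f' (y (j+1)), y (j+1+1) - y (j+1)⟫
      ≤ Lf * ‖y (j+1) - y j‖ * ‖y (j+1+1) - y (j+1)‖ := by
    refine (real_inner_le_norm _ _).trans ?_
    refine mul_le_mul_of_nonneg_right ?_ (norm_nonneg _)
    rw [norm_sub_rev (y (j+1))]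
    exact hlip _ _
  rw [hm, hm, hBf, hBf]
  generalize y (j+1+1) = y2 at *
  generalize y (j+1) = y1 at *
  generalize w (j+1+1) = w2 at *
  generalize w (j+1) = w1 at *
  generalize y j = y0 at *
  generalize f' y1 = g1 at *
  generalize f' y2 = g2 at *
  generalize f' y0 = g0 at *
  generalize f' ys = gs at *
  -- consecutive monotonicity
  have hmono : ⟪w2 - w1, y2 - y1⟫ ≤ Lf * ‖y1 - y0‖ * ‖y2 - y1‖ := by
    simp only [inner_sub_left, inner_sub_right, inner_add_left] at *
    linarith
  -- summed optimality conditions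
  have hmain : 1 / (2 * ρ) * ‖w2 - ws‖ ^ 2 + ρ / 2 * ‖y2 - ys‖ ^ 2 ≤
      1 / (2 * ρ) * ‖w1 - ws‖ ^ 2 + ρ / 2 * ‖y1 - ys‖ ^ 2 - 1 / (2 * ρ) * ‖w2 - w1‖ ^ 2
      - ρ / 2 * ‖y2 - y1‖ ^ 2 + ⟪w2 - w1, y2 - y1⟫ + ⟪gs - g1, y2 - ys⟫ := by
    have hsum : 0 ≤ ⟪(y2 - y1) - ρ⁻¹ • (w2 - ws), ys - y2 + ρ⁻¹ • (w2 - w1)⟫ * ρ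
        + ⟪w2 - ws + (g1 - gs), ys - y2⟫ := by
      have hX1' := mul_nonneg hX1 hρ0.le
      have e1 : ⟪y2 - ρ⁻¹ • (w2 - w1) - y1 - ρ⁻¹ • w1, ys - (y2 - ρ⁻¹ • (w2 - w1))⟫ * ρ
          - ⟪ws, y2 - ρ⁻¹ • (w2 - w1) - ys⟫
          = ⟪(y2 - y1) - ρ⁻¹ • (w2 - ws), ys - y2 + ρ⁻¹ • (w2 - w1)⟫ * ρ := by
        have ea : y2 - ρ⁻¹ • (w2 - w1) - y1 - ρ⁻¹ • w1
            = ((y2 - y1) - ρ⁻¹ • (w2 - ws)) - ρ⁻¹ • ws := by module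
        have eb : ys - (y2 - ρ⁻¹ • (w2 - w1)) = ys - y2 + ρ⁻¹ • (w2 - w1) := by abel
        have ec : y2 - ρ⁻¹ • (w2 - w1) - ys = -(ys - y2 + ρ⁻¹ • (w2 - w1)) := by abel
        rw [ea, eb, ec, inner_sub_left _ (ρ⁻¹ • ws), real_inner_smul_left ws, inner_neg_right]
        field_simp
        ring
      have e2 : ⟪w2 - ws + (g1 - gs), ys - y2⟫
          = ⟪w2 + g1, ys - y2⟫ - ⟪-ws - gs, y2 - ys⟫ := by
        simp only [inner_sub_left, inner_sub_right, inner_add_left, inner_neg_left]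
        ring
      linarith
    have ew : w1 - ws = (w2 - ws) - (w2 - w1) := by abel
    have ey : y1 - ys = - (ys - y2) - (y2 - y1) := by abel
    have ey2 : y2 - ys = - (ys - y2) := by abel
    rw [ew, ey, ey2]
    generalize ys - y2 = p at *
    generalize y2 - y1 = q at *
    generalize w2 - ws = r at *
    generalize w2 - w1 = s at *
    have ng : ⟪gs - g1, -p⟫ = ⟪g1 - gs, p⟫ := by
      rw [← neg_sub g1 gs, inner_neg_neg]
    rw [ng, norm_sub_sq_real, norm_sub_sq_real, inner_neg_left, norm_neg]
    simp only [inner_add_left _ _ p, inner_sub_left q, inner_add_right, real_inner_smul_left,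
      real_inner_smul_right, real_inner_comm q p, real_inner_comm s q] at hsum ⊢
    field_simp at hsum ⊢
    nlinarith
  have hcs := real_inner_le_norm (w2 - w1) (y2 - y1)
  have hbreg : ⟪gs - g1, y2 - ys⟫ - (f ys - f y2 - ⟪g2, ys - y2⟫) + (f ys - f y1 - ⟪g1, ys - y1⟫)
      ≤ Lf / 2 * ‖y2 - y1‖ ^ 2 := by
    simp only [inner_sub_left, inner_sub_right] at *
    linarith
  have hfin : - (1 / (2 * ρ) * ‖w2 - w1‖ ^ 2) - ρ / 2 * ‖y2 - y1‖ ^ 2 + ⟪w2 - w1, y2 - y1⟫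
      + Lf / 2 * ‖y2 - y1‖ ^ 2 + Lf ^ 2 / (2 * ρ) * ‖y2 - y1‖ ^ 2
      ≤ Lf ^ 2 / (2 * ρ) * ‖y1 - y0‖ ^ 2 := by
    generalize ‖y2 - y1‖ = a at *
    generalize ‖y1 - y0‖ = b at *
    generalize ‖w2 - w1‖ = q at *
    generalize ⟪w2 - w1, y2 - y1⟫ = i at *
    have e : Lf ^ 2 / (2 * ρ) * b ^ 2 - (- (1 / (2 * ρ) * q ^ 2) - ρ / 2 * a ^ 2 + i
      + Lf / 2 * a ^ 2 + Lf ^ 2 / (2 * ρ) * a ^ 2) =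
      (Lf ^ 2 * b ^ 2 + q ^ 2 + ρ ^ 2 * a ^ 2 - 2 * ρ * i - Lf * ρ * a ^ 2 - Lf ^ 2 * a ^ 2)
        / (2 * ρ) := by
      field_simp
      ring
    have h1 : ρ * i ≤ ρ * (Lf * b * a) := mul_le_mul_of_nonneg_left hmono hρ0.le
    have h2 : ρ * i ≤ ρ * (q * a) := mul_le_mul_of_nonneg_left hcs hρ0.le
    have h3 := mul_le_mul_of_nonneg_right hquad (sq_nonneg a)
    have := div_nonneg (a := Lf ^ 2 * b ^ 2 + q ^ 2 + ρ ^ 2 * a ^ 2 - 2 * ρ * i - Lf * ρ * a ^ 2 - Lf ^ 2 * a ^ 2) (b := 2 * ρ) (by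
      nlinarith [sq_nonneg (Lf * b - ρ * a / 2), sq_nonneg (q - ρ * a / 2)]) (by positivity)
    linarith
  linarith
end

section
/- Assume in addition that C is compact, the iterates (x^k, y^k, w^k), k ≥ 0, are generated by LP-ADMM steps with constant penalty parameter ρ > (√3 + 1)·L_f, and a KKT point exists. Then there exist x^∞ ∈ C, y^∞ ∈ ℝ^N, w^∞ ∈ ℝ^N such that (x^∞, y^∞, w^∞) is a KKT point and, as k → ∞, y^k → y^∞, w^k → w^∞, and Ax^k → y^∞. -/
open scoped RealInnerProductSpace
open Filter

section Helpers

variable {E : Type*} [NormedAddCommGroup E] [InnerProductSpace ℝ E]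

lemma lp_nonneg_of_small {a b : ℝ} (h : ∀ t : ℝ, 0 < t → t ≤ 1 → 0 ≤ a + t * b) : 0 ≤ a := by
  by_contra! ha
  have hb : 0 < b := by
    have := h 1 one_pos le_rfl
    linarith
  have h1 := h (min 1 (-a / (2 * b))) (lt_min one_pos (by apply div_pos <;> linarith)) (min_le_left _ _)
  have h2 : min 1 (-a / (2 * b)) * b ≤ -a / (2 * b) * b :=
    mul_le_mul_of_nonneg_right (min_le_right _ _) hb.le
  have h3 : -a / (2 * b) * b = -a / 2 := by field_simp
  linarith

lemma lp_prox {P : E → ℝ} {ρ : ℝ} {c y : E} (hP : ConvexOn ℝ Set.univ P)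
    (h : IsMinOn (fun z => ρ / 2 * ‖z - c‖ ^ 2 + P z) Set.univ y) (z : E) :
    P y + ρ * ⟪c - y, z - y⟫ ≤ P z := by
  have := lp_nonneg_of_small (a := P z - P y - ρ * ⟪c - y, z - y⟫) (b := ρ / 2 * ‖z - y‖ ^ 2) ?_
  · linarith
  intro t ht ht1
  have h1 := h (Set.mem_univ (y + t • (z - y)))
  simp only [Set.mem_ofPred_eq] at h1
  have h2 := hP.2 (Set.mem_univ y) (Set.mem_univ z) (sub_nonneg.2 ht1) ht.le (by ring)
  have h3 : (1 - t) • y + t • z = y + t • (z - y) := by module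
  rw [h3] at h2
  have h4 : y + t • (z - y) - c = t • (z - y) - (c - y) := by module
  have h5 : ‖y - c‖ ^ 2 = ‖c - y‖ ^ 2 := by rw [norm_sub_rev]
  rw [h4, h5, norm_sub_sq_real (t • (z - y)), norm_smul, real_inner_smul_left, real_inner_comm, mul_pow] at h1
  simp only [smul_eq_mul, Real.norm_eq_abs, sq_abs] at h1 h2
  have h6 : 0 ≤ t * (P z - P y - ρ * ⟪c - y, z - y⟫ + t * (ρ / 2 * ‖z - y‖ ^ 2)) := by nlinarith
  exact nonneg_of_mul_nonneg_right h6 ht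

lemma lp_proj {F : Type*} [NormedAddCommGroup F] [NormedSpace ℝ F] {C : Set F} (hC : Convex ℝ C)
    (A : F →L[ℝ] E) {a b : E} {x : F} (hx : x ∈ C)
    (h : IsMinOn (fun u => ‖A u - a - b‖ ^ 2) C x) (u : F) (hu : u ∈ C) :
    0 ≤ ⟪A x - a - b, A u - A x⟫ := by
  have := lp_nonneg_of_small (a := 2 * ⟪A x - a - b, A u - A x⟫) (b := ‖A u - A x‖ ^ 2) ?_
  · linarith
  intro t ht ht1
  have h1 := h (hC hx hu (sub_nonneg.2 ht1) ht.le (by ring))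
  simp only [Set.mem_ofPred_eq, map_add, map_smul] at h1
  have h4 : (1 - t) • A x + t • A u - a - b = (A x - a - b) + t • (A u - A x) := by module
  rw [h4, norm_add_sq_real, norm_smul, real_inner_smul_right, mul_pow] at h1
  simp only [Real.norm_eq_abs, sq_abs] at h1
  have h6 : 0 ≤ t * (2 * ⟪A x - a - b, A u - A x⟫ + t * (‖A u - A x‖ ^ 2)) := by nlinarith
  exact nonneg_of_mul_nonneg_right h6 ht

lemma lp_line [CompleteSpace E] {f : E → ℝ} {f' : E → E} (hgrad : ∀ z, HasGradientAt f (f' z) z) (a v : E) (t : ℝ) :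
    HasDerivAt (fun s : ℝ => f (a + s • v)) ⟪f' (a + t • v), v⟫ t := by
  have h1 : HasDerivAt (fun s : ℝ => a + s • v) v t := by
    simpa using ((hasDerivAt_id t).smul_const v).const_add a
  have h2 := (hgrad (a + t • v)).hasFDerivAt.comp_hasDerivAt t h1
  rw [InnerProductSpace.toDual_apply_apply] at h2
  exact h2

lemma lp_convex [CompleteSpace E] {f : E → ℝ} {f' : E → E} (hf : ConvexOn ℝ Set.univ f)
    (hgrad : ∀ z, HasGradientAt f (f' z) z) (a b : E) : f a + ⟪f' a, b - a⟫ ≤ f b := by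
  have hc : ConvexOn ℝ Set.univ (fun s : ℝ => f (a + s • (b - a))) := by
    refine ⟨convex_univ, fun s _ t _ p q hp hq hpq => ?_⟩
    have := hf.2 (Set.mem_univ (a + s • (b - a))) (Set.mem_univ (a + t • (b - a))) hp hq hpq
    convert this using 2
    obtain rfl : p = 1 - q := by linarith
    simp only [smul_eq_mul]
    module
  have := hc.le_slope_of_hasDerivAt (Set.mem_univ 0) (Set.mem_univ 1) one_pos (lp_line hgrad a (b - a) 0)
  simp [slope_def_field] at this
  linarith

lemma lp_descent [CompleteSpace E] {f : E → ℝ} {f' : E → E} {L : ℝ}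
    (hgrad : ∀ z, HasGradientAt f (f' z) z) (hlip : ∀ a b, ‖f' a - f' b‖ ≤ L * ‖a - b‖) (a v : E) :
    f (a + v) ≤ f a + ⟪f' a, v⟫ + L / 2 * ‖v‖ ^ 2 := by
  have hB : ∀ t : ℝ, HasDerivAt (fun s : ℝ => f a + s * ⟪f' a, v⟫ + s ^ 2 * (L / 2 * ‖v‖ ^ 2))
      (⟪f' a, v⟫ + t * (L * ‖v‖ ^ 2)) t := by
    intro t
    have := (((hasDerivAt_id t).mul_const ⟪f' a, v⟫).const_add (f a)).add
      (((hasDerivAt_id t).pow 2).mul_const (L / 2 * ‖v‖ ^ 2))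
    refine this.congr_deriv ?_
    simp only [id]
    push_cast
    ring
  have key := image_le_of_deriv_right_le_deriv_boundary (a := 0) (b := 1)
    (f := fun s : ℝ => f (a + s • v))
    (fun t _ => (lp_line hgrad a v t).continuousAt.continuousWithinAt)
    (fun t _ => (lp_line hgrad a v t).hasDerivWithinAt) (by simp)
    (fun t _ => (hB t).continuousAt.continuousWithinAt)
    (fun t _ => (hB t).hasDerivWithinAt) ?_ (Set.right_mem_Icc.2 zero_le_one)
  · simpa using key
  intro t ht
  have h1 := real_inner_le_norm (f' (a + t • v) - f' a) v
  have h2 := hlip (a + t • v) a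
  rw [add_sub_cancel_left, norm_smul, Real.norm_eq_abs, abs_of_nonneg ht.1] at h2
  have h3 := mul_le_mul_of_nonneg_right h2 (norm_nonneg v)
  rw [inner_sub_left] at h1
  nlinarith

lemma lp_coco [CompleteSpace E] {f : E → ℝ} {f' : E → E} {L : ℝ} (hL : 0 < L) (hf : ConvexOn ℝ Set.univ f)
    (hgrad : ∀ z, HasGradientAt f (f' z) z) (hlip : ∀ a b, ‖f' a - f' b‖ ≤ L * ‖a - b‖) (a b : E) :
    ‖f' b - f' a‖ ^ 2 ≤ L * ⟪f' b - f' a, b - a⟫ := by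
  have half : ∀ a b : E, f a + ⟪f' a, b - a⟫ + L⁻¹ / 2 * ‖f' b - f' a‖ ^ 2 ≤ f b := by
    intro a b
    have h1 := lp_descent hgrad hlip b (-(L⁻¹ • (f' b - f' a)))
    have h2 := lp_convex hf hgrad a (b + -(L⁻¹ • (f' b - f' a)))
    have h3 : b + -(L⁻¹ • (f' b - f' a)) - a = (b - a) - L⁻¹ • (f' b - f' a) := by module
    rw [h3, inner_sub_right, real_inner_smul_right] at h2
    rw [inner_neg_right, real_inner_smul_right, norm_neg, norm_smul, mul_pow, Real.norm_eq_abs,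
      sq_abs] at h1
    have h4 : ‖f' b - f' a‖ ^ 2 = ⟪f' b, f' b - f' a⟫ - ⟪f' a, f' b - f' a⟫ := by
      rw [← inner_sub_left, real_inner_self_eq_norm_sq]
    have h5 : L / 2 * (L⁻¹ ^ 2 * ‖f' b - f' a‖ ^ 2) = L⁻¹ / 2 * ‖f' b - f' a‖ ^ 2 := by
      field_simp
    have h6 : L⁻¹ * ‖f' b - f' a‖ ^ 2 = L⁻¹ * ⟪f' b, f' b - f' a⟫ - L⁻¹ * ⟪f' a, f' b - f' a⟫ := by
      rw [h4]; ring
    linarith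
  have h1 := half a b
  have h2 := half b a
  rw [norm_sub_rev (f' a)] at h2
  have h3 : ⟪f' b, a - b⟫ = - ⟪f' b, b - a⟫ := by rw [← inner_neg_right, neg_sub]
  have h4 : L⁻¹ * ‖f' b - f' a‖ ^ 2 ≤ ⟪f' b - f' a, b - a⟫ := by
    rw [inner_sub_left]; linarith
  calc _ = L * (L⁻¹ * ‖f' b - f' a‖ ^ 2) := by field_simp
    _ ≤ _ := mul_le_mul_of_nonneg_left h4 hL.le

lemma lp_step_aux {ρ L : ℝ} (hρ : 0 < ρ) (hL : 0 < L) {W Y d e r G H : E}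
    (h1 : 0 ≤ ⟪-W + ρ • d, -Y - r⟫) (h2 : 0 ≤ ⟪-W - G, Y⟫) (h3 : 0 ≤ ⟪ρ • r - H, d⟫)
    (h4 : ‖G‖ ^ 2 ≤ L * ⟪G, Y - d⟫) (h5 : ‖H‖ ≤ L * ‖e‖) :
    ρ⁻¹ * ‖W‖ ^ 2 + ρ * ‖Y‖ ^ 2 + L * ‖d‖ ^ 2 + ρ * ‖r‖ ^ 2 + (ρ - 5 / 2 * L) * ‖d‖ ^ 2
      ≤ ρ⁻¹ * ‖W + ρ • r‖ ^ 2 + ρ * ‖Y - d‖ ^ 2 + L * ‖e‖ ^ 2 := by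
  have h6 : ρ⁻¹ * ‖W + ρ • r‖ ^ 2 = ρ⁻¹ * ‖W‖ ^ 2 + 2 * ⟪W, r⟫ + ρ * ‖r‖ ^ 2 := by
    rw [norm_add_sq_real, norm_smul, mul_pow, real_inner_smul_right, Real.norm_eq_abs, sq_abs]
    field_simp
  have h7 : 0 ≤ ‖G + (L / 2) • d‖ ^ 2 := sq_nonneg _
  have h8 : 0 ≤ ‖H + L • d‖ ^ 2 := sq_nonneg _
  rw [norm_add_sq_real, norm_smul, mul_pow, real_inner_smul_right, Real.norm_eq_abs, sq_abs] at h7 h8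
  have h9 : ‖H‖ ^ 2 ≤ L ^ 2 * ‖e‖ ^ 2 := by
    rw [← mul_pow]; exact pow_le_pow_left₀ (norm_nonneg _) h5 2
  rw [h6, norm_sub_sq_real]
  simp only [inner_add_left, inner_sub_left, inner_sub_right, inner_neg_left, inner_neg_right,
    real_inner_smul_left] at h1 h2 h3 h4
  have h10 : 0 ≤ L * (2 * ⟪H, d⟫ + L * ‖e‖ ^ 2 + L * ‖d‖ ^ 2) := by nlinarith
  have h11 : 0 ≤ L * (⟪G, Y⟫ + L / 4 * ‖d‖ ^ 2) := by nlinarith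
  have h12 := nonneg_of_mul_nonneg_right h10 hL
  have h13 := nonneg_of_mul_nonneg_right h11 hL
  have h14 : ⟪Y, d⟫ = ⟪d, Y⟫ := real_inner_comm _ _
  have h15 : ⟪r, d⟫ = ⟪d, r⟫ := real_inner_comm _ _
  rw [h14]
  rw [h15] at h3
  linarith

lemma lp_step {ρ L : ℝ} (hρ : 0 < ρ) (hL : 0 < L) {y0 y y1 w w1 ys ws g g0 gs a : E}
    (hw : w1 = w - ρ • (a - y1))
    (h1 : 0 ≤ ⟪ws - w1 + ρ • (y1 - y), ys - a⟫) (h2 : 0 ≤ ⟪ws + gs - (w1 + g), y1 - ys⟫)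
    (h3 : 0 ≤ ⟪w + g0 - (w1 + g), y1 - y⟫)
    (h4 : ‖g - gs‖ ^ 2 ≤ L * ⟪g - gs, y - ys⟫) (h5 : ‖g - g0‖ ≤ L * ‖y - y0‖) :
    ρ⁻¹ * ‖w1 - ws‖ ^ 2 + ρ * ‖y1 - ys‖ ^ 2 + L * ‖y1 - y‖ ^ 2 + ρ * ‖a - y1‖ ^ 2
        + (ρ - 5 / 2 * L) * ‖y1 - y‖ ^ 2
      ≤ ρ⁻¹ * ‖w - ws‖ ^ 2 + ρ * ‖y - ys‖ ^ 2 + L * ‖y - y0‖ ^ 2 := by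
  have := lp_step_aux hρ hL (W := w1 - ws) (Y := y1 - ys) (d := y1 - y) (e := y - y0)
    (r := a - y1) (G := g - gs) (H := g - g0) ?_ ?_ ?_ ?_ h5
  · have e1 : w1 - ws + ρ • (a - y1) = w - ws := by rw [hw]; module
    have e2 : y1 - ys - (y1 - y) = y - ys := by abel
    rwa [e1, e2] at this
  · convert h1 using 2 <;> abel
  · convert h2 using 2; abel
  · convert h3 using 2; rw [hw]; module
  · convert h4 using 3; abel

end Helpers

/-- Theorem 4.3(a): with `C` compact, `ρ > (√3 + 1)L_f`, and a KKT point
existing, there is a KKT point `(x^∞, y^∞, w^∞)` such that `y^k → y^∞`,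
`w^k → w^∞`, and `Ax^k → y^∞`. -/
theorem lpadmm_global_convergence
    {n N : ℕ} (hn : 0 < n) (hN : 0 < N)
    (A : EuclideanSpace ℝ (Fin n) →L[ℝ] EuclideanSpace ℝ (Fin N))
    (C : Set (EuclideanSpace ℝ (Fin n)))
    (hCne : C.Nonempty) (hCconv : Convex ℝ C) (hCclosed : IsClosed C)
    (hCcompact : IsCompact C)
    (P : EuclideanSpace ℝ (Fin N) → ℝ) (hP : ConvexOn ℝ Set.univ P)
    (f : EuclideanSpace ℝ (Fin N) → ℝ) (hf : ConvexOn ℝ Set.univ f)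
    (f' : EuclideanSpace ℝ (Fin N) → EuclideanSpace ℝ (Fin N))
    (hgrad : ∀ z, HasGradientAt f (f' z) z)
    (Lf : ℝ) (hLf : 0 < Lf)
    (hlip : ∀ a b, ‖f' a - f' b‖ ≤ Lf * ‖a - b‖)
    (ρ : ℝ) (hρ : (Real.sqrt 3 + 1) * Lf < ρ)
    (x : ℕ → EuclideanSpace ℝ (Fin n)) (y w : ℕ → EuclideanSpace ℝ (Fin N))
    (hx : ∀ k, x (k+1) ∈ C ∧
      IsMinOn (fun u => ‖A u - y k - ρ⁻¹ • w k‖ ^ 2) C (x (k+1)))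
    (hy : ∀ k, IsMinOn
      (fun z => ρ / 2 * ‖z - (A (x (k+1)) - ρ⁻¹ • (w k + f' (y k)))‖ ^ 2 + P z)
      Set.univ (y (k+1)))
    (hw : ∀ k, w (k+1) = w k - ρ • (A (x (k+1)) - y (k+1)))
    (hkkt_exists : ∃ (xs : EuclideanSpace ℝ (Fin n))
        (ys ws : EuclideanSpace ℝ (Fin N)),
      xs ∈ C ∧ A xs = ys ∧ (∀ xx ∈ C, ⟪ws, A xx - A xs⟫ ≤ 0) ∧
        (∀ z, P ys + ⟪-ws - f' ys, z - ys⟫ ≤ P z)) :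
    ∃ (xinf : EuclideanSpace ℝ (Fin n)) (yinf winf : EuclideanSpace ℝ (Fin N)),
      xinf ∈ C ∧ A xinf = yinf ∧
      (∀ xx ∈ C, ⟪winf, A xx - A xinf⟫ ≤ 0) ∧
      (∀ z, P yinf + ⟪-winf - f' yinf, z - yinf⟫ ≤ P z) ∧
      Tendsto y atTop (nhds yinf) ∧
      Tendsto w atTop (nhds winf) ∧
      Tendsto (fun k => A (x k)) atTop (nhds yinf) := by
  have hρ0 : 0 < ρ := lt_trans (by positivity) hρ
  have hρ2 : 5 / 2 * Lf < ρ := by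
    refine lt_of_le_of_lt (mul_le_mul_of_nonneg_right ?_ hLf.le) hρ
    have : (3 / 2 : ℝ) ≤ Real.sqrt 3 := Real.le_sqrt_of_sq_le (by norm_num)
    linarith
  -- optimality conditions of the two subproblems
  have ox : ∀ k, ∀ u ∈ C, 0 ≤ ⟪-w (k+1) + ρ • (y (k+1) - y k), A u - A (x (k+1))⟫ := by
    intro k u hu
    have h := lp_proj hCconv A (hx k).1 (hx k).2 u hu
    have e : -w (k+1) + ρ • (y (k+1) - y k) = ρ • (A (x (k+1)) - y k - ρ⁻¹ • w k) := by
      rw [hw k, smul_sub ρ _ (ρ⁻¹ • w k), smul_inv_smul₀ hρ0.ne']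
      module
    rw [e, real_inner_smul_left]
    exact mul_nonneg hρ0.le h
  have oy : ∀ k z, P (y (k+1)) + ⟪-w (k+1) - f' (y k), z - y (k+1)⟫ ≤ P z := by
    intro k z
    have h := lp_prox hP (hy k) z
    have e : -w (k+1) - f' (y k) =
        ρ • (A (x (k+1)) - ρ⁻¹ • (w k + f' (y k)) - y (k+1)) := by
      rw [hw k, smul_sub, smul_sub, smul_sub, smul_inv_smul₀ hρ0.ne']
      module
    rwa [e, real_inner_smul_left]
  -- the Lyapunov inequality at an arbitrary KKT point
  have step : ∀ (xs : EuclideanSpace ℝ (Fin n)) (ys ws : EuclideanSpace ℝ (Fin N)),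
      xs ∈ C → A xs = ys → (∀ xx ∈ C, ⟪ws, A xx - A xs⟫ ≤ 0) →
      (∀ z, P ys + ⟪-ws - f' ys, z - ys⟫ ≤ P z) → ∀ k,
      (ρ⁻¹ * ‖w (k+1+1) - ws‖ ^ 2 + ρ * ‖y (k+1+1) - ys‖ ^ 2
        + Lf * ‖y (k+1+1) - y (k+1)‖ ^ 2) + (ρ * ‖A (x (k+1+1)) - y (k+1+1)‖ ^ 2
        + (ρ - 5 / 2 * Lf) * ‖y (k+1+1) - y (k+1)‖ ^ 2)
      ≤ ρ⁻¹ * ‖w (k+1) - ws‖ ^ 2 + ρ * ‖y (k+1) - ys‖ ^ 2 + Lf * ‖y (k+1) - y k‖ ^ 2 := by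
    intro xs ys ws hxs hAs hk1 hk2 k
    rw [← add_assoc]
    refine lp_step hρ0 hLf (hw (k+1)) (g := f' (y (k+1))) (g0 := f' (y k)) (gs := f' ys)
      ?_ ?_ ?_ (lp_coco hLf hf hgrad hlip ys (y (k+1))) (hlip _ _)
    · have a1 := ox (k+1) xs hxs
      have a2 := hk1 _ (hx (k+1)).1
      rw [hAs] at a1 a2
      have e : ⟪ws - w (k+1+1) + ρ • (y (k+1+1) - y (k+1)), ys - A (x (k+1+1))⟫ =
          ⟪-w (k+1+1) + ρ • (y (k+1+1) - y (k+1)), ys - A (x (k+1+1))⟫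
          - ⟪ws, A (x (k+1+1)) - ys⟫ := by
        rw [← neg_sub ys (A (x (k+1+1))), inner_neg_right, sub_neg_eq_add, ← inner_add_left]
        congr 1; abel
      rw [e]; linarith
    · have a1 := oy (k+1) ys
      have a2 := hk2 (y (k+1+1))
      rw [← neg_sub (y (k+1+1)) ys, inner_neg_right] at a1
      have e : ⟪ws + f' ys - (w (k+1+1) + f' (y (k+1))), y (k+1+1) - ys⟫ =
          ⟪-w (k+1+1) - f' (y (k+1)), y (k+1+1) - ys⟫
          - ⟪-ws - f' ys, y (k+1+1) - ys⟫ := by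
        rw [← inner_sub_left]
        congr 1; abel
      rw [e]; linarith
    · have a1 := oy (k+1) (y (k+1))
      have a2 := oy k (y (k+1+1))
      rw [← neg_sub (y (k+1+1)) (y (k+1)), inner_neg_right] at a1
      have e : ⟪w (k+1) + f' (y k) - (w (k+1+1) + f' (y (k+1))), y (k+1+1) - y (k+1)⟫ =
          ⟪-w (k+1+1) - f' (y (k+1)), y (k+1+1) - y (k+1)⟫
          - ⟪-w (k+1) - f' (y k), y (k+1+1) - y (k+1)⟫ := by
        rw [← inner_sub_left]
        congr 1; abel
      rw [e]; linarith
  -- generic consequences of the Lyapunov inequality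
  obtain ⟨xs, ys, ws, hxs, hAs, hk1, hk2⟩ := hkkt_exists
  have hδ0 : ∀ k, 0 ≤ ρ * ‖A (x (k+1+1)) - y (k+1+1)‖ ^ 2
        + (ρ - 5 / 2 * Lf) * ‖y (k+1+1) - y (k+1)‖ ^ 2 := fun k => by
    have : 0 < ρ - 5 / 2 * Lf := by linarith
    positivity
  let V : EuclideanSpace ℝ (Fin N) → EuclideanSpace ℝ (Fin N) → ℕ → ℝ := fun ys ws k =>
    ρ⁻¹ * ‖w (k+1) - ws‖ ^ 2 + ρ * ‖y (k+1) - ys‖ ^ 2 + Lf * ‖y (k+1) - y k‖ ^ 2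
  have hV0 : ∀ ys ws k, 0 ≤ V ys ws k := fun ys ws k => by
    simp only [V]; positivity
  have hVanti : Antitone (V ys ws) := antitone_nat_of_succ_le fun k => by
    have := step xs ys ws hxs hAs hk1 hk2 k
    have := hδ0 k
    simp only [V]; linarith
  have hVlim := tendsto_atTop_ciInf hVanti ⟨0, by rintro _ ⟨k, rfl⟩; exact hV0 ys ws k⟩
  have hδlim : Tendsto (fun k => ρ * ‖A (x (k+1+1)) - y (k+1+1)‖ ^ 2
        + (ρ - 5 / 2 * Lf) * ‖y (k+1+1) - y (k+1)‖ ^ 2) atTop (nhds 0) := by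
    have h1 := hVlim.sub (hVlim.comp (tendsto_add_atTop_nat 1))
    rw [sub_self] at h1
    refine squeeze_zero hδ0 (fun k => ?_) h1
    have := step xs ys ws hxs hAs hk1 hk2 k
    simp only [V, Function.comp]
    linarith
  have hc : 0 < ρ - 5 / 2 * Lf := by linarith
  have lim_of : ∀ (u : ℕ → EuclideanSpace ℝ (Fin N)) (c : ℝ) (b : ℕ → ℝ), 0 < c →
      (∀ k, c * ‖u k‖ ^ 2 ≤ b k) → Tendsto b atTop (nhds 0) → Tendsto u atTop (nhds 0) := by
    intro u c b hc hb hlim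
    have h1 : Tendsto (fun k => ‖u k‖ ^ 2) atTop (nhds 0) := by
      refine squeeze_zero (fun k => sq_nonneg _) (fun k => ?_)
        (by simpa using hlim.const_mul c⁻¹)
      rw [← div_eq_inv_mul, le_div_iff₀ hc, mul_comm]
      exact hb k
    rw [tendsto_zero_iff_norm_tendsto_zero]
    have h2 := h1.sqrt
    simpa [Real.sqrt_sq (norm_nonneg _)] using h2
  have hr : Tendsto (fun k => A (x (k+1)) - y (k+1)) atTop (nhds 0) := by
    rw [← tendsto_add_atTop_iff_nat 1]
    refine lim_of _ ρ _ hρ0 (fun k => ?_) hδlim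
    have : 0 ≤ (ρ - 5 / 2 * Lf) * ‖y (k+1+1) - y (k+1)‖ ^ 2 := by positivity
    linarith
  have hd : Tendsto (fun k => y (k+1) - y k) atTop (nhds 0) := by
    rw [← tendsto_add_atTop_iff_nat 1]
    refine lim_of _ _ _ hc (fun k => ?_) hδlim
    have : 0 ≤ ρ * ‖A (x (k+1+1)) - y (k+1+1)‖ ^ 2 := by positivity
    linarith
  -- boundedness and a convergent subsequence
  have bdd : ∀ (u : ℕ → EuclideanSpace ℝ (Fin N)) (us : EuclideanSpace ℝ (Fin N)) (c : ℝ), 0 < c →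
      (∀ k, c * ‖u k - us‖ ^ 2 ≤ V ys ws k) →
      ∀ k, u k ∈ Metric.closedBall us (Real.sqrt (c⁻¹ * V ys ws 0)) := by
    intro u us c hc hb k
    rw [mem_closedBall_iff_norm]
    apply Real.le_sqrt_of_sq_le
    rw [← div_eq_inv_mul, le_div_iff₀ hc, mul_comm]
    exact (hb k).trans (hVanti (Nat.zero_le k))
  have hby := bdd (fun k => y (k+1)) ys ρ hρ0 (fun k => by
    have h1 : 0 ≤ ρ⁻¹ * ‖w (k+1) - ws‖ ^ 2 := by positivity
    have h2 : 0 ≤ Lf * ‖y (k+1) - y k‖ ^ 2 := by positivity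
    simp only [V]; linarith)
  have hbw := bdd (fun k => w (k+1)) ws ρ⁻¹ (inv_pos.2 hρ0) (fun k => by
    have h1 : 0 ≤ ρ * ‖y (k+1) - ys‖ ^ 2 := by positivity
    have h2 : 0 ≤ Lf * ‖y (k+1) - y k‖ ^ 2 := by positivity
    simp only [V]; linarith)
  obtain ⟨⟨xi, yi, wi⟩, hmem, φ, hφ, hlim⟩ :=
    (hCcompact.prod ((isCompact_closedBall ys _).prod (isCompact_closedBall ws _))).tendsto_subseq
      (x := fun k => (x (k+1), y (k+1), w (k+1)))
      (fun k => ⟨(hx k).1, hby k, hbw k⟩)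
  have hxi : xi ∈ C := hmem.1
  have lx : Tendsto (fun k => x (φ k + 1)) atTop (nhds xi) :=
    (continuous_fst.tendsto _).comp hlim
  have ly : Tendsto (fun k => y (φ k + 1)) atTop (nhds yi) :=
    ((continuous_fst.comp continuous_snd).tendsto _).comp hlim
  have lw : Tendsto (fun k => w (φ k + 1)) atTop (nhds wi) :=
    ((continuous_snd.comp continuous_snd).tendsto _).comp hlim
  have ld : Tendsto (fun k => y (φ k + 1) - y (φ k)) atTop (nhds 0) := hd.comp hφ.tendsto_atTop
  have lr : Tendsto (fun k => A (x (φ k + 1)) - y (φ k + 1)) atTop (nhds 0) :=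
    hr.comp hφ.tendsto_atTop
  have lAx : Tendsto (fun k => A (x (φ k + 1))) atTop (nhds (A xi)) :=
    (A.continuous.tendsto _).comp lx
  have ly0 : Tendsto (fun k => y (φ k)) atTop (nhds yi) := by
    simpa using ly.sub ld
  have hAxi : A xi = yi := by
    have := tendsto_nhds_unique (lAx.sub ly) lr
    exact sub_eq_zero.1 this
  have hPc : Continuous P := hP.locallyLipschitz.continuous
  have hf'c : Continuous f' :=
    (LipschitzWith.of_dist_le_mul (K := ⟨Lf, hLf.le⟩) (fun a b => by
      rw [dist_eq_norm, dist_eq_norm]; exact hlip a b)).continuous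
  have kk1 : ∀ xx ∈ C, ⟪wi, A xx - A xi⟫ ≤ 0 := by
    intro u hu
    have h1 : Tendsto (fun k => ⟪-w (φ k + 1) + ρ • (y (φ k + 1) - y (φ k)),
        A u - A (x (φ k + 1))⟫) atTop (nhds ⟪-wi + ρ • (0 : EuclideanSpace ℝ (Fin N)), A u - A xi⟫) :=
      (lw.neg.add (ld.const_smul ρ)).inner (lAx.const_sub (A u))
    have h2 := ge_of_tendsto' h1 (fun k => ox (φ k) u hu)
    simp only [smul_zero, add_zero, inner_neg_left] at h2
    linarith
  have kk2 : ∀ z, P yi + ⟪-wi - f' yi, z - yi⟫ ≤ P z := by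
    intro z
    have h1 : Tendsto (fun k => P (y (φ k + 1)) + ⟪-w (φ k + 1) - f' (y (φ k)),
        z - y (φ k + 1)⟫) atTop (nhds (P yi + ⟪-wi - f' yi, z - yi⟫)) :=
      ((hPc.tendsto _).comp ly).add
        ((lw.neg.sub ((hf'c.tendsto _).comp ly0)).inner (ly.const_sub z))
    exact le_of_tendsto' h1 (fun k => oy (φ k) z)
  -- the Lyapunov function at the limit point tends to zero
  have hWanti : Antitone (V yi wi) := antitone_nat_of_succ_le fun k => by
    have := step xi yi wi hxi hAxi kk1 kk2 k
    have := hδ0 k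
    simp only [V]; linarith
  have hWlim := tendsto_atTop_ciInf hWanti ⟨0, by rintro _ ⟨k, rfl⟩; exact hV0 yi wi k⟩
  have hWsub : Tendsto (fun k => V yi wi (φ k)) atTop (nhds 0) := by
    have h1 : Tendsto (fun k => V yi wi (φ k)) atTop
        (nhds (ρ⁻¹ * ‖wi - wi‖ ^ 2 + ρ * ‖yi - yi‖ ^ 2
          + Lf * ‖(0 : EuclideanSpace ℝ (Fin N))‖ ^ 2)) :=
      ((((lw.sub_const wi).norm.pow 2).const_mul _).add
        (((ly.sub_const yi).norm.pow 2).const_mul _)).add ((ld.norm.pow 2).const_mul _)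
    simpa using h1
  have hW0 : Tendsto (V yi wi) atTop (nhds 0) := by
    have := tendsto_nhds_unique (hWlim.comp hφ.tendsto_atTop) hWsub
    rwa [this] at hWlim
  have fy : Tendsto (fun k => y (k+1)) atTop (nhds yi) := by
    rw [← tendsto_sub_nhds_zero_iff]
    refine lim_of _ ρ _ hρ0 (fun k => ?_) hW0
    have h1 : 0 ≤ ρ⁻¹ * ‖w (k+1) - wi‖ ^ 2 := by positivity
    have h2 : 0 ≤ Lf * ‖y (k+1) - y k‖ ^ 2 := by positivity
    simp only [V]; linarith
  have fw : Tendsto (fun k => w (k+1)) atTop (nhds wi) := by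
    rw [← tendsto_sub_nhds_zero_iff]
    refine lim_of _ ρ⁻¹ _ (inv_pos.2 hρ0) (fun k => ?_) hW0
    have h1 : 0 ≤ ρ * ‖y (k+1) - yi‖ ^ 2 := by positivity
    have h2 : 0 ≤ Lf * ‖y (k+1) - y k‖ ^ 2 := by positivity
    simp only [V]; linarith
  refine ⟨xi, yi, wi, hxi, hAxi, kk1, kk2, (tendsto_add_atTop_iff_nat 1).1 fy,
    (tendsto_add_atTop_iff_nat 1).1 fw, (tendsto_add_atTop_iff_nat 1).1 ?_⟩
  simpa using hr.add fy
end
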